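/- Let k be a field and H a Hopf algebra over k with bijective antipode. Assume that the category of left-right Long dimodules over H satisfies condition (†), and that the coinvariants functor M ↦ M^{coH} on right H-comodules is exact. Then every Long dimodule M that is finitely generated as a left H-module is a projective object in the category of Long dimodules. -/

import Mathlib

/-!
Common definitions for formalizing "Semisimplicity of the categories of
Yetter-Drinfeld modules and Long dimodules" (Caenepeel, Guédénon).
-/

open TensorProduct

noncomputable section
namespace YDPaper

section RingPart

variable (k H : Type) [CommRing k] [Ring H] [HopfAlgebra k H]

/-- `ρ : M →ₗ[k] M ⊗[k] H` is a (coassociative, counital) right `H`-comodule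
structure on `M`. -/
def IsComod {M : Type} [AddCommGroup M] [Module k M] (ρ : M →ₗ[k] M ⊗[k] H) : Prop :=
  (∀ m : M, (TensorProduct.rid k M)
      ((LinearMap.lTensor M (Coalgebra.counit (R := k) (A := H))) (ρ m)) = m) ∧
  (∀ m : M, (TensorProduct.assoc k M H H) ((LinearMap.rTensor H ρ) (ρ m)) =
      (LinearMap.lTensor M (Coalgebra.comul (R := k) (A := H))) (ρ m))

/-- The iterated comultiplication `h ↦ (h₁ ⊗ h₂) ⊗ h₃`. -/
def Delta2 : H →ₗ[k] (H ⊗[k] H) ⊗[k] H :=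
  (LinearMap.rTensor H (Coalgebra.comul (R := k) (A := H))).comp
    (Coalgebra.comul (R := k) (A := H))

/-- The Yetter-Drinfeld compatibility condition
`ρ(h • m) = h₂ • m₀ ⊗ h₃ m₁ S⁻¹(h₁)`, expressed via arbitrary Sweedler
decompositions of `Δ²(h)` and `ρ(m)` into finite sums of pure tensors. -/
def IsYDCompat (Sinv : H →ₗ[k] H) {M : Type} [AddCommGroup M] [Module k M] [Module H M]
    (ρ : M →ₗ[k] M ⊗[k] H) : Prop :=
  ∀ (h : H) (m : M) (s t : Finset ℕ) (a b c : ℕ → H) (m₀ : ℕ → M) (m₁ : ℕ → H),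
    (∑ i ∈ s, (a i ⊗ₜ[k] b i) ⊗ₜ[k] c i) = Delta2 k H h →
    (∑ j ∈ t, m₀ j ⊗ₜ[k] m₁ j) = ρ m →
    ρ (h • m) = ∑ i ∈ s, ∑ j ∈ t, (b i • m₀ j) ⊗ₜ[k] (c i * m₁ j * Sinv (a i))

/-- The `k`-linear map `m ↦ h • m`. -/
def smulMap {M : Type} [AddCommGroup M] [Module k M] [Module H M] [SMulCommClass H k M]
    (h : H) : M →ₗ[k] M where
  toFun m := h • m
  map_add' := smul_add h
  map_smul' c m := (smul_comm h c m)

/-- The Long dimodule compatibility condition `ρ(h • m) = h • m₀ ⊗ m₁`. -/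
def IsLongCompat {M : Type} [AddCommGroup M] [Module k M] [Module H M] [SMulCommClass H k M]
    (ρ : M →ₗ[k] M ⊗[k] H) : Prop :=
  ∀ (h : H) (m : M), ρ (h • m) = (LinearMap.rTensor H (smulMap k H h)) (ρ m)

/-- Morphisms in the categories of Yetter-Drinfeld modules and of Long dimodules:
`H`-linear and `H`-colinear maps. -/
def IsHom {A B : Type} [AddCommGroup A] [Module k A] [Module H A]
    [AddCommGroup B] [Module k B] [Module H B]
    (ρA : A →ₗ[k] A ⊗[k] H) (ρB : B →ₗ[k] B ⊗[k] H) (f : A →ₗ[k] B) : Prop :=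
  (∀ (h : H) (a : A), f (h • a) = h • f a) ∧
  ρB.comp f = (LinearMap.rTensor H f).comp ρA

/-- `H`-colinearity of a `k`-linear map between right `H`-comodules. -/
def IsColin {A B : Type} [AddCommGroup A] [Module k A]
    [AddCommGroup B] [Module k B]
    (ρA : A →ₗ[k] A ⊗[k] H) (ρB : B →ₗ[k] B ⊗[k] H) (f : A →ₗ[k] B) : Prop :=
  ρB.comp f = (LinearMap.rTensor H f).comp ρA

/-- A bundled left-right Yetter-Drinfeld module over `H` (with chosen inverse `Sinv`
of the antipode). -/
structure YDCat (Sinv : H →ₗ[k] H) where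
  M : Type
  [iAdd : AddCommGroup M]
  [iModk : Module k M]
  [iModH : Module H M]
  [iTower : IsScalarTower k H M]
  [iComm : SMulCommClass H k M]
  ρ : M →ₗ[k] M ⊗[k] H
  comod : IsComod k H ρ
  compat : IsYDCompat k H Sinv ρ

attribute [instance] YDCat.iAdd YDCat.iModk YDCat.iModH YDCat.iTower YDCat.iComm

/-- A bundled left-right Long dimodule over `H`. -/
structure LongCat where
  M : Type
  [iAdd : AddCommGroup M]
  [iModk : Module k M]
  [iModH : Module H M]
  [iTower : IsScalarTower k H M]
  [iComm : SMulCommClass H k M]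
  ρ : M →ₗ[k] M ⊗[k] H
  comod : IsComod k H ρ
  compat : IsLongCompat k H ρ

attribute [instance] LongCat.iAdd LongCat.iModk LongCat.iModH LongCat.iTower LongCat.iComm

/-- A bundled right `H`-comodule. -/
structure ComodCat where
  V : Type
  [iAdd : AddCommGroup V]
  [iModk : Module k V]
  ρ : V →ₗ[k] V ⊗[k] H
  comod : IsComod k H ρ

attribute [instance] ComodCat.iAdd ComodCat.iModk

section Subobjects

variable {k H}
variable {M : Type} [AddCommGroup M] [Module k M] [Module H M] [IsScalarTower k H M]

/-- A subobject in the category of Yetter-Drinfeld modules (or Long dimodules):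
an `H`-submodule which is stable under the coaction, i.e. `ρ(p) ⊆ p ⊗ H`. -/
def IsSubobject (ρ : M →ₗ[k] M ⊗[k] H) (p : Submodule H M) : Prop :=
  ∀ m ∈ p, ρ m ∈ LinearMap.range (LinearMap.rTensor H (p.restrictScalars k).subtype)

/-- A simple subobject: a nonzero coaction-stable `H`-submodule with no proper
nonzero coaction-stable `H`-submodules. -/
def IsSimpleSubobject (ρ : M →ₗ[k] M ⊗[k] H) (p : Submodule H M) : Prop :=
  IsSubobject ρ p ∧ p ≠ ⊥ ∧
    ∀ q : Submodule H M, IsSubobject ρ q → q ≤ p → q = ⊥ ∨ q = p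

/-- `M` is the (internal) direct sum of a family of simple subobjects which are
finitely generated as `H`-modules. -/
def IsSemisimpleObj (ρ : M →ₗ[k] M ⊗[k] H) : Prop :=
  ∃ (ι : Type) (S : ι → Submodule H M),
    (∀ i, IsSimpleSubobject ρ (S i) ∧ (S i).FG) ∧
    iSupIndep S ∧ (⨆ i, S i) = ⊤

end Subobjects

section Subcomodules

variable {k H}
variable {V : Type} [AddCommGroup V] [Module k V]

/-- A subcomodule: a `k`-submodule stable under the coaction. -/
def IsSubcomod (ρ : V →ₗ[k] V ⊗[k] H) (p : Submodule k V) : Prop :=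
  ∀ v ∈ p, ρ v ∈ LinearMap.range (LinearMap.rTensor H p.subtype)

/-- A simple subcomodule. -/
def IsSimpleSubcomod (ρ : V →ₗ[k] V ⊗[k] H) (p : Submodule k V) : Prop :=
  IsSubcomod ρ p ∧ p ≠ ⊥ ∧
    ∀ q : Submodule k V, IsSubcomod ρ q → q ≤ p → q = ⊥ ∨ q = p

/-- A comodule is semisimple if it is the internal direct sum of a family of simple
subcomodules. -/
def IsSemisimpleComod (ρ : V →ₗ[k] V ⊗[k] H) : Prop :=
  ∃ (ι : Type) (S : ι → Submodule k V),
    (∀ i, IsSimpleSubcomod ρ (S i)) ∧ iSupIndep S ∧ (⨆ i, S i) = ⊤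

end Subcomodules

/-- `H` is cosemisimple: every right `H`-comodule is a direct sum of simple
subcomodules. -/
def Cosemisimple : Prop := ∀ C : ComodCat k H, IsSemisimpleComod C.ρ

section Coinv

variable {k H}
variable {A B : Type} [AddCommGroup A] [Module k A] [AddCommGroup B] [Module k B]

/-- The coinvariants `M^{co H} = { m | ρ m = m ⊗ 1 }` of a right `H`-comodule. -/
def coinv (ρ : A →ₗ[k] A ⊗[k] H) : Submodule k A :=
  LinearMap.ker (ρ - (TensorProduct.mk k A H).flip 1)

lemma mem_coinv {ρ : A →ₗ[k] A ⊗[k] H} {a : A} :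
    a ∈ coinv ρ ↔ ρ a = a ⊗ₜ[k] (1 : H) := by
  simp [coinv, LinearMap.mem_ker, sub_eq_zero]

/-- The map induced on coinvariants by an `H`-colinear map. -/
def coinvMap {ρA : A →ₗ[k] A ⊗[k] H} {ρB : B →ₗ[k] B ⊗[k] H} (f : A →ₗ[k] B)
    (hf : IsColin k H ρA ρB f) : ↥(coinv ρA) →ₗ[k] ↥(coinv ρB) :=
  f.restrict (fun a ha => by
    have h1 : ρA a = a ⊗ₜ[k] (1 : H) := mem_coinv.1 ha
    have h2 : ρB (f a) = (LinearMap.rTensor H f) (ρA a) := by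
      have := congrArg (fun (g : A →ₗ[k] B ⊗[k] H) => g a) hf
      simpa using this
    rw [mem_coinv, h2, h1, LinearMap.rTensor_tmul])

end Coinv

/-- Exactness of the coinvariants functor on the category of Yetter-Drinfeld
modules. -/
def CoinvExactYD (Sinv : H →ₗ[k] H) : Prop :=
  ∀ (A B C : YDCat k H Sinv) (f : A.M →ₗ[k] B.M) (g : B.M →ₗ[k] C.M)
    (hf : IsHom k H A.ρ B.ρ f) (hg : IsHom k H B.ρ C.ρ g),
    Function.Injective f → Function.Surjective g →
    LinearMap.range f = LinearMap.ker g →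
    Function.Injective (coinvMap f hf.2) ∧
    LinearMap.range (coinvMap f hf.2) = LinearMap.ker (coinvMap g hg.2) ∧
    Function.Surjective (coinvMap g hg.2)

/-- Exactness of the coinvariants functor on the category of right `H`-comodules. -/
def CoinvExactComod : Prop :=
  ∀ (A B C : ComodCat k H) (f : A.V →ₗ[k] B.V) (g : B.V →ₗ[k] C.V)
    (hf : IsColin k H A.ρ B.ρ f) (hg : IsColin k H B.ρ C.ρ g),
    Function.Injective f → Function.Surjective g →
    LinearMap.range f = LinearMap.ker g →
    Function.Injective (coinvMap f hf) ∧
    LinearMap.range (coinvMap f hf) = LinearMap.ker (coinvMap g hg) ∧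
    Function.Surjective (coinvMap g hg)

section Eval

variable {k H}
variable {M N : Type} [AddCommGroup M] [Module k M] [Module H M]
  [IsScalarTower k H M] [SMulCommClass H k M]
  [AddCommGroup N] [Module k N] [Module H N] [IsScalarTower k H N] [SMulCommClass H k N]

/-- Evaluation at `m` of `H`-linear maps, as a `k`-linear map. -/
def evalAtH (m : M) : (M →ₗ[H] N) →ₗ[k] N where
  toFun f := f m
  map_add' _ _ := rfl
  map_smul' _ _ := rfl

/-- Evaluation at `m` of `k`-linear maps, as a `k`-linear map. -/
def evalAtK {V : Type} [AddCommGroup V] [Module k V] (v : V) :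
    (V →ₗ[k] N) →ₗ[k] N where
  toFun f := f v
  map_add' _ _ := rfl
  map_smul' _ _ := rfl

/-- Contraction `N ⊗ H → N` along a functional `φ : H → k`. -/
def contract (φ : H →ₗ[k] k) : N ⊗[k] H →ₗ[k] N :=
  (TensorProduct.rid k N).toLinearMap.comp (LinearMap.lTensor N φ)

/-- Post-composition with an `H`-linear map, as a `k`-linear map
`Hom_H(X, M) → Hom_H(X, N)`; here `X` is the (implicit) source. -/
def postcompH {X : Type} [AddCommGroup X] [Module k X] [Module H X]
    [IsScalarTower k H X] [SMulCommClass H k X]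
    (f : M →ₗ[k] N) (hf : ∀ (h : H) (m : M), f (h • m) = h • f m) :
    (X →ₗ[H] M) →ₗ[k] (X →ₗ[H] N) where
  toFun φ :=
    { toFun := fun x => f (φ x)
      map_add' := fun x y => by simp
      map_smul' := fun h x => by simp [hf] }
  map_add' φ ψ := by ext x; simp
  map_smul' c φ := by ext x; simp

end Eval

/-- Condition (†) for the category of Yetter-Drinfeld modules: for every
Yetter-Drinfeld module `X` which is finitely generated as a left `H`-module,
the functor `Hom_H(X, -)` is exact on the category of Yetter-Drinfeld modules. -/
def DaggerYD (Sinv : H →ₗ[k] H) : Prop :=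
  ∀ X : YDCat k H Sinv, Module.Finite H X.M →
  ∀ (A B C : YDCat k H Sinv) (f : A.M →ₗ[k] B.M) (g : B.M →ₗ[k] C.M)
    (hf : IsHom k H A.ρ B.ρ f) (hg : IsHom k H B.ρ C.ρ g),
    Function.Injective f → Function.Surjective g →
    LinearMap.range f = LinearMap.ker g →
    Function.Injective (postcompH (X := X.M) f hf.1) ∧
    LinearMap.range (postcompH (X := X.M) f hf.1) =
      LinearMap.ker (postcompH (X := X.M) g hg.1) ∧
    Function.Surjective (postcompH (X := X.M) g hg.1)

/-- Condition (†) for the category of Long dimodules. -/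
def DaggerLong : Prop :=
  ∀ X : LongCat k H, Module.Finite H X.M →
  ∀ (A B C : LongCat k H) (f : A.M →ₗ[k] B.M) (g : B.M →ₗ[k] C.M)
    (hf : IsHom k H A.ρ B.ρ f) (hg : IsHom k H B.ρ C.ρ g),
    Function.Injective f → Function.Surjective g →
    LinearMap.range f = LinearMap.ker g →
    Function.Injective (postcompH (X := X.M) f hf.1) ∧
    LinearMap.range (postcompH (X := X.M) f hf.1) =
      LinearMap.ker (postcompH (X := X.M) g hg.1) ∧
    Function.Surjective (postcompH (X := X.M) g hg.1)

/-- Projective object in the category of Yetter-Drinfeld modules. -/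
def IsProjectiveYD (Sinv : H →ₗ[k] H) (P : YDCat k H Sinv) : Prop :=
  ∀ (A B : YDCat k H Sinv) (g : A.M →ₗ[k] B.M) (f : P.M →ₗ[k] B.M),
    IsHom k H A.ρ B.ρ g → Function.Surjective g → IsHom k H P.ρ B.ρ f →
    ∃ l : P.M →ₗ[k] A.M, IsHom k H P.ρ A.ρ l ∧ g.comp l = f

/-- Projective object in the category of Long dimodules. -/
def IsProjectiveLong (P : LongCat k H) : Prop :=
  ∀ (A B : LongCat k H) (g : A.M →ₗ[k] B.M) (f : P.M →ₗ[k] B.M),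
    IsHom k H A.ρ B.ρ g → Function.Surjective g → IsHom k H P.ρ B.ρ f →
    ∃ l : P.M →ₗ[k] A.M, IsHom k H P.ρ A.ρ l ∧ g.comp l = f

/-- Injective object in the category of Yetter-Drinfeld modules. -/
def IsInjectiveYD (Sinv : H →ₗ[k] H) (I : YDCat k H Sinv) : Prop :=
  ∀ (A B : YDCat k H Sinv) (ι : A.M →ₗ[k] B.M) (f : A.M →ₗ[k] I.M),
    IsHom k H A.ρ B.ρ ι → Function.Injective ι → IsHom k H A.ρ I.ρ f →
    ∃ g : B.M →ₗ[k] I.M, IsHom k H B.ρ I.ρ g ∧ g.comp ι = f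

/-- Projective object in the category of right `H`-comodules. -/
def IsProjectiveComod (P : ComodCat k H) : Prop :=
  ∀ (A B : ComodCat k H) (g : A.V →ₗ[k] B.V) (f : P.V →ₗ[k] B.V),
    IsColin k H A.ρ B.ρ g → Function.Surjective g → IsColin k H P.ρ B.ρ f →
    ∃ l : P.V →ₗ[k] A.V, IsColin k H P.ρ A.ρ l ∧ g.comp l = f

section HomLemmas

variable {k H}
variable {A B C : Type} [AddCommGroup A] [Module k A] [Module H A]
  [AddCommGroup B] [Module k B] [Module H B]
  [AddCommGroup C] [Module k C] [Module H C]

lemma IsHom.comp' {ρA : A →ₗ[k] A ⊗[k] H} {ρB : B →ₗ[k] B ⊗[k] H} {ρC : C →ₗ[k] C ⊗[k] H}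
    {f : A →ₗ[k] B} {g : B →ₗ[k] C}
    (hf : IsHom k H ρA ρB f) (hg : IsHom k H ρB ρC g) :
    IsHom k H ρA ρC (g.comp f) := by
  refine ⟨fun h a => by simp [LinearMap.comp_apply, hf.1, hg.1], ?_⟩
  calc ρC.comp (g.comp f) = (ρC.comp g).comp f := by rw [LinearMap.comp_assoc]
    _ = ((LinearMap.rTensor H g).comp ρB).comp f := by rw [hg.2]
    _ = (LinearMap.rTensor H g).comp (ρB.comp f) := by rw [LinearMap.comp_assoc]
    _ = (LinearMap.rTensor H g).comp ((LinearMap.rTensor H f).comp ρA) := by rw [hf.2]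
    _ = ((LinearMap.rTensor H g).comp (LinearMap.rTensor H f)).comp ρA := by
          rw [LinearMap.comp_assoc]
    _ = (LinearMap.rTensor H (g.comp f)).comp ρA := by rw [LinearMap.rTensor_comp]

end HomLemmas

section HomYD

variable {k H}
variable (Sinv : H →ₗ[k] H)

/-- The `k`-module of morphisms of Yetter-Drinfeld modules `Hom_H^H(A, B)`, as a
submodule of the `k`-linear maps. -/
def homYD (A B : YDCat k H Sinv) : Submodule k (A.M →ₗ[k] B.M) where
  carrier := {f | IsHom k H A.ρ B.ρ f}
  add_mem' := by
    rintro f g ⟨hf1, hf2⟩ ⟨hg1, hg2⟩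
    refine ⟨fun h a => by simp [hf1, hg1, smul_add], ?_⟩
    rw [LinearMap.comp_add, LinearMap.rTensor_add, LinearMap.add_comp, hf2, hg2]
  zero_mem' := by
    refine ⟨fun h a => by simp, ?_⟩
    rw [LinearMap.comp_zero, LinearMap.rTensor_zero, LinearMap.zero_comp]
  smul_mem' := by
    rintro c f ⟨hf1, hf2⟩
    refine ⟨fun h a => by
      rw [LinearMap.smul_apply, LinearMap.smul_apply, hf1, smul_comm], ?_⟩
    rw [LinearMap.comp_smul, LinearMap.rTensor_smul, LinearMap.smul_comp, hf2]

/-- Post-composition with a morphism of Yetter-Drinfeld modules, as a `k`-linear map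
between morphism spaces. -/
def postcompYD {X B C : YDCat k H Sinv}
    (g : B.M →ₗ[k] C.M) (hg : IsHom k H B.ρ C.ρ g) :
    ↥(homYD Sinv X B) →ₗ[k] ↥(homYD Sinv X C) where
  toFun f := ⟨g.comp f.1, IsHom.comp' f.2 hg⟩
  map_add' f g' := by ext x; simp
  map_smul' c f := by ext x; simp

/-- An injective resolution `0 → X → I⁰ → I¹ → ⋯` in the category of
Yetter-Drinfeld modules. -/
structure IsInjRes (X : YDCat k H Sinv) (I : ℕ → YDCat k H Sinv)
    (ε : X.M →ₗ[k] (I 0).M) (d : ∀ n, (I n).M →ₗ[k] (I (n + 1)).M) : Prop where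
  eps_hom : IsHom k H X.ρ (I 0).ρ ε
  d_hom : ∀ n, IsHom k H (I n).ρ (I (n + 1)).ρ (d n)
  inj : ∀ n, IsInjectiveYD k H Sinv (I n)
  mono : Function.Injective ε
  exact0 : LinearMap.range ε = LinearMap.ker (d 0)
  exact : ∀ n, LinearMap.range (d n) = LinearMap.ker (d (n + 1))

/-- A projective resolution `⋯ → P₁ → P₀ → X → 0` in the category of
Yetter-Drinfeld modules. -/
structure IsProjRes (X : YDCat k H Sinv) (P : ℕ → YDCat k H Sinv)
    (ε : (P 0).M →ₗ[k] X.M) (d : ∀ n, (P (n + 1)).M →ₗ[k] (P n).M) : Prop where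
  eps_hom : IsHom k H (P 0).ρ X.ρ ε
  d_hom : ∀ n, IsHom k H (P (n + 1)).ρ (P n).ρ (d n)
  proj : ∀ n, IsProjectiveYD k H Sinv (P n)
  epi : Function.Surjective ε
  exact0 : LinearMap.range (d 0) = LinearMap.ker ε
  exact : ∀ n, LinearMap.range (d (n + 1)) = LinearMap.ker (d n)

/-- The projective dimension of `X` in the category of Yetter-Drinfeld modules is
at most `n`. -/
def pdimLE (X : YDCat k H Sinv) (n : ℕ) : Prop :=
  ∃ (P : ℕ → YDCat k H Sinv) (ε : (P 0).M →ₗ[k] X.M)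
    (d : ∀ m, (P (m + 1)).M →ₗ[k] (P m).M),
    IsProjRes Sinv X P ε d ∧ ∀ i, n < i → Subsingleton (P i).M

/-- The injective dimension of `X` in the category of Yetter-Drinfeld modules is
at most `n`. -/
def injdimLE (X : YDCat k H Sinv) (n : ℕ) : Prop :=
  ∃ (I : ℕ → YDCat k H Sinv) (ε : X.M →ₗ[k] (I 0).M)
    (d : ∀ m, (I m).M →ₗ[k] (I (m + 1)).M),
    IsInjRes Sinv X I ε d ∧ ∀ i, n < i → Subsingleton (I i).M

/-- The complex `Hom(X, I⁰) → Hom(X, I¹) → ⋯` of morphism spaces induced by a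
cochain of Yetter-Drinfeld modules. -/
def homCx (X : YDCat k H Sinv) (I : ℕ → YDCat k H Sinv)
    (d : ∀ n, (I n).M →ₗ[k] (I (n + 1)).M)
    (hd : ∀ n, IsHom k H (I n).ρ (I (n + 1)).ρ (d n)) (n : ℕ) :
    ↥(homYD Sinv X (I n)) →ₗ[k] ↥(homYD Sinv X (I (n + 1))) :=
  postcompYD Sinv (d n) (hd n)

/-- Coboundaries of the induced complex. -/
def boundaries (X : YDCat k H Sinv) (I : ℕ → YDCat k H Sinv)
    (d : ∀ n, (I n).M →ₗ[k] (I (n + 1)).M)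
    (hd : ∀ n, IsHom k H (I n).ρ (I (n + 1)).ρ (d n)) :
    ∀ i, Submodule k ↥(homYD Sinv X (I i))
  | 0 => ⊥
  | (i + 1) => LinearMap.range (homCx Sinv X I d hd i)

/-- The `i`-th cohomology (cocycles modulo coboundaries) of the complex
`Hom(X, I⁰) → Hom(X, I¹) → ⋯`; when `I` is an injective resolution of `Y`, this is
`Ext^i(X, Y)`, the `i`-th right derived functor of `Hom_H^H(X, -)`, in the category
of Yetter-Drinfeld modules. -/
abbrev cohomology (X : YDCat k H Sinv) (I : ℕ → YDCat k H Sinv)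
    (d : ∀ n, (I n).M →ₗ[k] (I (n + 1)).M)
    (hd : ∀ n, IsHom k H (I n).ρ (I (n + 1)).ρ (d n)) (i : ℕ) : Type :=
  ↥(Submodule.map (boundaries Sinv X I d hd i).mkQ
      (LinearMap.ker (homCx Sinv X I d hd i)))

end HomYD

section CharProps

variable {k H}
variable (Sinv : H →ₗ[k] H)

/-- Characterizing property of the coaction on `Hom_H(A, B)` for Yetter-Drinfeld
modules `A`, `B`: it is determined by `f₀(m) ⊗ f₁ = f(m₀)₀ ⊗ f(m₀)₁ S(m₁)`. -/
def HomCoactChar (A B : YDCat k H Sinv)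
    (ρQ : (A.M →ₗ[H] B.M) →ₗ[k] (A.M →ₗ[H] B.M) ⊗[k] H) : Prop :=
  ∀ (f : A.M →ₗ[H] B.M) (m : A.M) (t : Finset ℕ) (m₀ : ℕ → A.M) (m₁ : ℕ → H),
    (∑ j ∈ t, m₀ j ⊗ₜ[k] m₁ j) = A.ρ m →
    (LinearMap.rTensor H (evalAtH (N := B.M) m)) (ρQ f) =
      ∑ j ∈ t, (LinearMap.lTensor B.M
          (LinearMap.mulRight k (HopfAlgebra.antipode (R := k) (A := H) (m₁ j))))
        (B.ρ (f (m₀ j)))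

/-- Characterizing property of the coaction on `Hom_k(V, B)` for a comodule `V` and
a Yetter-Drinfeld module `B`: `g₀(v) ⊗ g₁ = g(v₀)₀ ⊗ g(v₀)₁ S(v₁)`. -/
def HomKCoactChar (V : ComodCat k H) (B : YDCat k H Sinv)
    (ρ' : (V.V →ₗ[k] B.M) →ₗ[k] (V.V →ₗ[k] B.M) ⊗[k] H) : Prop :=
  ∀ (g : V.V →ₗ[k] B.M) (v : V.V) (t : Finset ℕ) (v₀ : ℕ → V.V) (v₁ : ℕ → H),
    (∑ j ∈ t, v₀ j ⊗ₜ[k] v₁ j) = V.ρ v →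
    (LinearMap.rTensor H (evalAtK (N := B.M) v)) (ρ' g) =
      ∑ j ∈ t, (LinearMap.lTensor B.M
          (LinearMap.mulRight k (HopfAlgebra.antipode (R := k) (A := H) (v₁ j))))
        (B.ρ (g (v₀ j)))

/-- Characterizing property of the Yetter-Drinfeld coaction on `H ⊗ V`:
`ρ(h ⊗ v) = h₂ ⊗ v₀ ⊗ h₃ v₁ S⁻¹(h₁)`. -/
def HTensorYDChar (V : ComodCat k H)
    (ρT : (H ⊗[k] V.V) →ₗ[k] (H ⊗[k] V.V) ⊗[k] H) : Prop :=
  ∀ (h : H) (v : V.V) (s t : Finset ℕ) (a b c : ℕ → H) (v₀ : ℕ → V.V) (v₁ : ℕ → H),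
    (∑ i ∈ s, (a i ⊗ₜ[k] b i) ⊗ₜ[k] c i) = Delta2 k H h →
    (∑ j ∈ t, v₀ j ⊗ₜ[k] v₁ j) = V.ρ v →
    ρT (h ⊗ₜ[k] v) =
      ∑ i ∈ s, ∑ j ∈ t, (b i ⊗ₜ[k] v₀ j) ⊗ₜ[k] (c i * v₁ j * Sinv (a i))

/-- Characterizing property of the Long dimodule coaction on `H ⊗ V`:
`ρ(h ⊗ v) = h ⊗ v₀ ⊗ v₁`. -/
def HTensorLongChar (V : ComodCat k H)
    (ρT : (H ⊗[k] V.V) →ₗ[k] (H ⊗[k] V.V) ⊗[k] H) : Prop :=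
  ∀ (h : H) (v : V.V) (t : Finset ℕ) (v₀ : ℕ → V.V) (v₁ : ℕ → H),
    (∑ j ∈ t, v₀ j ⊗ₜ[k] v₁ j) = V.ρ v →
    ρT (h ⊗ₜ[k] v) = ∑ j ∈ t, (h ⊗ₜ[k] v₀ j) ⊗ₜ[k] v₁ j

end CharProps

end RingPart

section CommPart

variable {k H : Type} [CommRing k] [CommRing H] [HopfAlgebra k H] (Sinv : H →ₗ[k] H)

/-- Characterizing property of the Yetter-Drinfeld coaction on `M ⊗_H N`:
`ρ(m ⊗ n) = m₀ ⊗ n₀ ⊗ n₁ m₁` (for `H` commutative). -/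
def TensorCoactChar (A B : YDCat k H Sinv)
    (ρT : (A.M ⊗[H] B.M) →ₗ[k] (A.M ⊗[H] B.M) ⊗[k] H) : Prop :=
  ∀ (m : A.M) (n : B.M) (s t : Finset ℕ) (m₀ : ℕ → A.M) (m₁ : ℕ → H)
    (n₀ : ℕ → B.M) (n₁ : ℕ → H),
    (∑ i ∈ s, m₀ i ⊗ₜ[k] m₁ i) = A.ρ m →
    (∑ j ∈ t, n₀ j ⊗ₜ[k] n₁ j) = B.ρ n →
    ρT (m ⊗ₜ[H] n) =
      ∑ i ∈ s, ∑ j ∈ t, (m₀ i ⊗ₜ[H] n₀ j) ⊗ₜ[k] (n₁ j * m₁ i)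

/-- Restriction along `v ↦ 1 ⊗ v`, i.e. the canonical map
`Hom_H(H ⊗ V, N) → Hom_k(V, N)`, `f ↦ (v ↦ f(1 ⊗ v))`. -/
def resUnitMap (V : Type) [AddCommGroup V] [Module k V] (N : Type) [AddCommGroup N]
    [Module k N] [Module H N] [IsScalarTower k H N] [SMulCommClass H k N] :
    ((H ⊗[k] V) →ₗ[H] N) →ₗ[k] (V →ₗ[k] N) where
  toFun f := (f.restrictScalars k).comp ((TensorProduct.mk k H V) 1)
  map_add' f g := by ext v; rfl
  map_smul' c f := by ext v; rfl

end CommPart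

open WithConv Coalgebra in
theorem anti_comul (k H : Type) [CommRing k] [Ring H] [HopfAlgebra k H] :
    (comul (R := k) (A := H)) ∘ₗ HopfAlgebra.antipode k (A := H) =
     (TensorProduct.map (HopfAlgebra.antipode k (A := H)) (HopfAlgebra.antipode k (A := H))) ∘ₗ
      (TensorProduct.comm k H H).toLinearMap ∘ₗ comul := by
  apply WithConv.toConv_injective
  symm
  refine left_inv_eq_right_inv (a := toConv (comul (R := k) (A := H))) ?_
    LinearMap.comul_right_inv
  apply WithConv.ext
  simp only [LinearMap.convMul_def, LinearMap.convOne_def, ofConv_toConv]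
  -- reassociation
  have key : (LinearMap.lTensor H (TensorProduct.assoc k H H H).symm.toLinearMap) ∘ₗ
      (TensorProduct.assoc k H H (H ⊗[k] H)).toLinearMap ∘ₗ
      TensorProduct.map (comul (R := k) (A := H)) (comul (R := k) (A := H)) ∘ₗ comul =
      (LinearMap.lTensor H (LinearMap.rTensor H (comul (R := k) (A := H)))) ∘ₗ
      (LinearMap.lTensor H (comul (R := k) (A := H))) ∘ₗ comul := by
    simp only [coassoc_simps]
  let S := HopfAlgebra.antipode k (A := H)
  -- a ⊗ ((p ⊗ q) ⊗ d) ↦ (S p * q) ⊗ (S a * d)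
  let F : H ⊗[k] ((H ⊗[k] H) ⊗[k] H) →ₗ[k] H ⊗[k] H :=
    (TensorProduct.map (LinearMap.mul' k H ∘ₗ LinearMap.rTensor H S)
      (LinearMap.mul' k H ∘ₗ LinearMap.rTensor H S)) ∘ₗ
      (TensorProduct.leftComm k H (H ⊗[k] H) H).toLinearMap
  have h1 : LinearMap.mul' k (H ⊗[k] H) ∘ₗ TensorProduct.map
      ((TensorProduct.map S S) ∘ₗ (TensorProduct.comm k H H).toLinearMap ∘ₗ comul) comul ∘ₗ comul
      = F ∘ₗ (LinearMap.lTensor H (TensorProduct.assoc k H H H).symm.toLinearMap) ∘ₗ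
      (TensorProduct.assoc k H H (H ⊗[k] H)).toLinearMap ∘ₗ
      TensorProduct.map (comul (R := k) (A := H)) (comul (R := k) (A := H)) ∘ₗ comul := by
    have : LinearMap.mul' k (H ⊗[k] H) ∘ₗ TensorProduct.map
      ((TensorProduct.map S S) ∘ₗ (TensorProduct.comm k H H).toLinearMap) LinearMap.id
      = F ∘ₗ (LinearMap.lTensor H (TensorProduct.assoc k H H H).symm.toLinearMap) ∘ₗ
      (TensorProduct.assoc k H H (H ⊗[k] H)).toLinearMap := by
      ext a b c d
      simp [F]
    have h2 : TensorProduct.map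
      ((TensorProduct.map S S) ∘ₗ (TensorProduct.comm k H H).toLinearMap ∘ₗ comul) comul
       = TensorProduct.map
      ((TensorProduct.map S S) ∘ₗ (TensorProduct.comm k H H).toLinearMap) LinearMap.id ∘ₗ
       TensorProduct.map comul (comul (R := k) (A := H)) := by
      rw [← TensorProduct.map_comp, LinearMap.id_comp, LinearMap.comp_assoc]
    rw [h2, LinearMap.comp_assoc, ← LinearMap.comp_assoc, this]
    simp only [LinearMap.comp_assoc]
  refine h1.trans ?_
  rw [key]
  have h3 : F ∘ₗ LinearMap.lTensor H (LinearMap.rTensor H (comul (R := k) (A := H))) =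
      (TensorProduct.mk k H H 1) ∘ₗ (LinearMap.mul' k H) ∘ₗ
       TensorProduct.map S ((TensorProduct.lid k H).toLinearMap ∘ₗ LinearMap.rTensor H (counit (R := k) (A := H))) := by
    ext a b d
    simp [F, S]
    rw [Algebra.algebraMap_eq_smul_one, smul_tmul, tmul_smul]
  rw [← LinearMap.comp_assoc, h3]
  ext h
  simp only [LinearMap.comp_apply]
  have h4 : ∀ x : H ⊗[k] H, TensorProduct.map S ((TensorProduct.lid k H).toLinearMap ∘ₗ LinearMap.rTensor H (counit (R := k) (A := H)))
     (LinearMap.lTensor H (comul (R := k) (A := H)) x) = LinearMap.rTensor H S x := by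
    intro x
    induction x with
    | zero => simp
    | add x y hx hy => simp only [map_add, hx, hy]
    | tmul x y => simp [Coalgebra.rTensor_counit_comul]
  rw [h4]
  simp [S]
  rw [Algebra.algebraMap_eq_smul_one, smul_tmul]

section Aux

variable {k H : Type} [Field k] [Ring H] [HopfAlgebra k H]

lemma exists_lift {X Y Z : Type} [AddCommGroup X] [Module k X] [AddCommGroup Y] [Module k Y]
    [AddCommGroup Z] [Module k Z] (j : X →ₗ[k] Y) (hj : Function.Injective j)
    (φ : Z →ₗ[k] Y) (h : ∀ z, φ z ∈ LinearMap.range j) :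
    ∃ ψ : Z →ₗ[k] X, ∀ z, j (ψ z) = φ z := by
  refine ⟨(LinearEquiv.ofInjective j hj).symm.toLinearMap ∘ₗ φ.codRestrict _ h, fun z => ?_⟩
  have := LinearEquiv.apply_symm_apply (LinearEquiv.ofInjective j hj) (φ.codRestrict _ h z)
  exact congrArg Subtype.val this

lemma coord_nat {P Q Y ι : Type} [DecidableEq ι] [AddCommGroup P] [Module k P]
    [AddCommGroup Q] [Module k Q]
    [AddCommGroup Y] [Module k Y] (b : Module.Basis ι k Y) (f : P →ₗ[k] Q) (x : P ⊗[k] Y) (i : ι) :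
    TensorProduct.equivFinsuppOfBasisRight b (LinearMap.rTensor Y f x) i =
      f (TensorProduct.equivFinsuppOfBasisRight b x i) := by
  induction x with
  | zero => simp
  | add x y hx hy => simp only [map_add, Finsupp.add_apply, hx, hy]
  | tmul x y => simp

section Ev
variable {M N : Type} [AddCommGroup M] [Module k M] [Module H M]
  [IsScalarTower k H M] [SMulCommClass H k M]
  [AddCommGroup N] [Module k N] [Module H N] [IsScalarTower k H N] [SMulCommClass H k N]
  {Y : Type} [AddCommGroup Y] [Module k Y]

lemma eval_inj (x y : (M →ₗ[H] N) ⊗[k] Y)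
    (hx : ∀ m : M, LinearMap.rTensor Y (evalAtH (k := k) m) x =
      LinearMap.rTensor Y (evalAtH (k := k) m) y) : x = y := by
  classical
  let b := Module.Basis.ofVectorSpace k Y
  apply (TensorProduct.equivFinsuppOfBasisRight b).injective
  ext i m
  have h := congrArg (fun z => TensorProduct.equivFinsuppOfBasisRight b z i) (hx m)
  simp only [coord_nat] at h
  exact h

lemma eval_surj (hM : Module.Finite H M) (φ : M →ₗ[k] N ⊗[k] Y)
    (hφ : ∀ (h : H) (m : M), φ (h • m) = LinearMap.rTensor Y (smulMap k H h) (φ m)) :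
    ∃ x : (M →ₗ[H] N) ⊗[k] Y, ∀ m : M, LinearMap.rTensor Y (evalAtH (k := k) m) x = φ m := by
  classical
  let b := Module.Basis.ofVectorSpace k Y
  let e := TensorProduct.equivFinsuppOfBasisRight (M := N) b
  let φc : _ → (M →ₗ[H] N) := fun i =>
    { toFun := fun m => e (φ m) i
      map_add' := fun x y => by simp
      map_smul' := fun h x => by
        simp only [hφ, e, coord_nat]
        rfl }
  obtain ⟨s, hs⟩ := hM.fg_top
  let t := s.biUnion (fun m => (e (φ m)).support)
  have ht : ∀ i, i ∉ t → φc i = 0 := by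
    intro i hi
    apply LinearMap.ext_on hs
    intro m hm
    have : i ∉ (e (φ m)).support := fun h => hi (Finset.mem_biUnion.2 ⟨m, hm, h⟩)
    exact Finsupp.notMem_support_iff.1 this
  refine ⟨∑ i ∈ t, φc i ⊗ₜ[k] b i, fun m => ?_⟩
  apply e.injective
  ext i
  have h2 : e (φ m) i = φc i m := rfl
  rw [h2]
  simp only [e, coord_nat]
  simp only [map_sum, Finsupp.finsetSum_apply,
    TensorProduct.equivFinsuppOfBasisRight_apply_tmul_apply, Module.Basis.repr_self,
    Finsupp.single_apply, ite_smul, one_smul, zero_smul,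
    Finset.sum_ite_eq']
  by_cases hi : i ∈ t
  · rw [if_pos hi]
    rfl
  · rw [if_neg hi, ht i hi]
    simp
end Ev

section Co
variable {A B : Type} [AddCommGroup A] [Module k A] [AddCommGroup B] [Module k B]

lemma isComod_of_injective {ρA : A →ₗ[k] A ⊗[k] H} {ρB : B →ₗ[k] B ⊗[k] H} (ι : A →ₗ[k] B)
    (hι : Function.Injective ι) (h : ∀ a, LinearMap.rTensor H ι (ρA a) = ρB (ι a))
    (hB : IsComod k H ρB) : IsComod k H ρA := by
  constructor
  · intro a
    apply hι
    have h1 : ∀ x : A ⊗[k] H, ι (TensorProduct.rid k A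
        (LinearMap.lTensor A (Coalgebra.counit (R := k) (A := H)) x)) =
        TensorProduct.rid k B (LinearMap.lTensor B (Coalgebra.counit (R := k) (A := H))
          (LinearMap.rTensor H ι x)) := by
      intro x
      induction x with
      | zero => simp
      | add x y hx hy => simp only [map_add, hx, hy]
      | tmul x y => simp
    rw [h1, h, hB.1]
  · intro a
    apply Module.Flat.rTensor_preserves_injective_linearMap (M := H ⊗[k] H) ι hι
    have h1 : ∀ x : A ⊗[k] H, LinearMap.rTensor (H ⊗[k] H) ι
        (TensorProduct.assoc k A H H (LinearMap.rTensor H ρA x)) =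
        TensorProduct.assoc k B H H (LinearMap.rTensor H ρB (LinearMap.rTensor H ι x)) := by
      intro x
      induction x with
      | zero => simp
      | add x y hx hy => simp only [map_add, hx, hy]
      | tmul x y =>
        simp only [LinearMap.rTensor_tmul, ← h]
        generalize ρA x = z
        induction z with
        | zero => simp
        | add x y hx hy => simp only [map_add, hx, hy, add_tmul]
        | tmul x y => simp
    have h2 : ∀ x : A ⊗[k] H, LinearMap.rTensor (H ⊗[k] H) ι
        (LinearMap.lTensor A (Coalgebra.comul (R := k) (A := H)) x) =
        LinearMap.lTensor B (Coalgebra.comul (R := k) (A := H)) (LinearMap.rTensor H ι x) := by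
      intro x
      induction x with
      | zero => simp
      | add x y hx hy => simp only [map_add, hx, hy]
      | tmul x y => simp
    rw [h1, h2, h, hB.2]

end Co

/-- The kernel of a morphism of Long dimodules. -/
lemma exists_kernel (A B : LongCat k H) (g : A.M →ₗ[k] B.M) (hg : IsHom k H A.ρ B.ρ g) :
    ∃ (K : LongCat k H) (ι : K.M →ₗ[k] A.M), IsHom k H K.ρ A.ρ ι ∧ Function.Injective ι ∧
      LinearMap.range ι = LinearMap.ker g := by
  let gH : A.M →ₗ[H] B.M := { toFun := g, map_add' := map_add g, map_smul' := hg.1 }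
  let K := LinearMap.ker gH
  let ι : K →ₗ[k] A.M := K.subtype.restrictScalars k
  have hι : Function.Injective ι := Subtype.val_injective
  have hex : LinearMap.range ι = LinearMap.ker g := by
    ext x
    constructor
    · rintro ⟨y, rfl⟩
      exact y.2
    · intro hx
      exact ⟨⟨x, hx⟩, rfl⟩
  have hι2 := Module.Flat.rTensor_preserves_injective_linearMap (M := H) ι hι
  have hex2 : Function.Exact (LinearMap.rTensor H ι) (LinearMap.rTensor H g) :=
    Module.Flat.rTensor_exact H (LinearMap.exact_iff.2 hex.symm)
  have hgρ : ∀ a, B.ρ (g a) = LinearMap.rTensor H g (A.ρ a) := fun a => LinearMap.congr_fun hg.2 a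
  obtain ⟨ρK, hρK⟩ := exists_lift (LinearMap.rTensor H ι) hι2 (A.ρ ∘ₗ ι) (by
    intro z
    apply (hex2 _).1
    have : g (ι z) = 0 := z.2
    rw [LinearMap.comp_apply, ← hgρ, this, map_zero])
  have : SMulCommClass H k K := ⟨fun h c x => Subtype.ext (smul_comm h c x.1)⟩
  have : IsScalarTower k H K := ⟨fun h c x => Subtype.ext (smul_assoc h c x.1)⟩
  refine ⟨{ M := K, ρ := ρK, comod := isComod_of_injective ι hι hρK A.comod, compat := ?_ },
    ι, ⟨fun h a => rfl, ?_⟩, hι, hex⟩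
  · intro h m
    apply hι2
    rw [hρK]
    have h1 : ι ∘ₗ smulMap k H h = smulMap k H h ∘ₗ ι := rfl
    rw [← LinearMap.comp_apply (LinearMap.rTensor H ι), ← LinearMap.rTensor_comp, h1,
      LinearMap.rTensor_comp, LinearMap.comp_apply (LinearMap.rTensor H (smulMap k H h)), hρK]
    exact A.compat h (ι m)
  · ext x
    exact (hρK x).symm
section Theta
variable {A B : Type} [AddCommGroup A] [Module k A] [AddCommGroup B] [Module k B]

/-- `a ⊗ s ↦ a₀ ⊗ a₁ s`. -/
def theta (ρ : A →ₗ[k] A ⊗[k] H) : A ⊗[k] H →ₗ[k] A ⊗[k] H :=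
  LinearMap.lTensor A (LinearMap.mul' k H) ∘ₗ (TensorProduct.assoc k A H H).toLinearMap ∘ₗ
    LinearMap.rTensor H ρ

lemma theta_tmul (ρ : A →ₗ[k] A ⊗[k] H) (a : A) (s : H) :
    theta ρ (a ⊗ₜ s) = LinearMap.lTensor A (LinearMap.mulRight k s) (ρ a) := by
  simp only [theta, LinearMap.comp_apply, LinearMap.rTensor_tmul, LinearEquiv.coe_coe]
  generalize ρ a = z
  induction z with
  | zero => simp
  | add x y hx hy => simp only [map_add, hx, hy, add_tmul]
  | tmul x y => simp

lemma theta_nat {ρA : A →ₗ[k] A ⊗[k] H} {ρB : B →ₗ[k] B ⊗[k] H} (g : A →ₗ[k] B)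
    (h : ∀ a, ρB (g a) = LinearMap.rTensor H g (ρA a)) (v : A ⊗[k] H) :
    theta ρB (LinearMap.rTensor H g v) = LinearMap.rTensor H g (theta ρA v) := by
  induction v with
  | zero => simp
  | add x y hx hy => simp only [map_add, hx, hy]
  | tmul x y =>
    rw [LinearMap.rTensor_tmul, theta_tmul, theta_tmul, h]
    generalize ρA x = z
    induction z with
    | zero => simp
    | add x y hx hy => simp only [map_add, hx, hy]
    | tmul x y => simp

/-- `m ↦ f(m₀)₀ ⊗ f(m₀)₁ S(m₁)`. -/
def homT (ρA : A →ₗ[k] A ⊗[k] H) (ρB : B →ₗ[k] B ⊗[k] H) (f : A →ₗ[k] B) : A →ₗ[k] B ⊗[k] H :=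
  theta ρB ∘ₗ TensorProduct.map f (HopfAlgebra.antipode k (A := H)) ∘ₗ ρA

lemma homT_eq_of_colin {ρA : A →ₗ[k] A ⊗[k] H} {ρB : B →ₗ[k] B ⊗[k] H} (f : A →ₗ[k] B)
    (hA : IsComod k H ρA)
    (h : ∀ a, ρB (f a) = LinearMap.rTensor H f (ρA a)) (a : A) :
    homT ρA ρB f a = f a ⊗ₜ (1 : H) := by
  have h1 : TensorProduct.map f (HopfAlgebra.antipode k (A := H)) (ρA a) =
      LinearMap.rTensor H f (LinearMap.lTensor A (HopfAlgebra.antipode k (A := H)) (ρA a)) := by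
    rw [← LinearMap.comp_apply (LinearMap.rTensor H f), LinearMap.rTensor_comp_lTensor]
  have h2 : theta ρA (LinearMap.lTensor A (HopfAlgebra.antipode k (A := H)) (ρA a)) =
      a ⊗ₜ (1 : H) := by
    have h3 : ∀ u : A ⊗[k] H, theta ρA (LinearMap.lTensor A (HopfAlgebra.antipode k (A := H)) u) =
        LinearMap.lTensor A (LinearMap.mul' k H ∘ₗ
          LinearMap.lTensor H (HopfAlgebra.antipode k (A := H)))
          (TensorProduct.assoc k A H H (LinearMap.rTensor H ρA u)) := by
      intro u
      induction u with
      | zero => simp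
      | add x y hx hy => simp only [map_add, hx, hy]
      | tmul x y =>
        rw [LinearMap.lTensor_tmul, theta_tmul, LinearMap.rTensor_tmul]
        generalize ρA x = z
        induction z with
        | zero => simp
        | add x y hx hy => simp only [map_add, hx, hy, add_tmul]
        | tmul x y => simp
    rw [h3, hA.2]
    have h4 : ∀ u : A ⊗[k] H, LinearMap.lTensor A (LinearMap.mul' k H ∘ₗ
          LinearMap.lTensor H (HopfAlgebra.antipode k (A := H)))
          (LinearMap.lTensor A (Coalgebra.comul (R := k) (A := H)) u) =
        (TensorProduct.rid k A
          (LinearMap.lTensor A (Coalgebra.counit (R := k) (A := H)) u)) ⊗ₜ (1 : H) := by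
      intro u
      induction u with
      | zero => simp
      | add x y hx hy => simp only [map_add, hx, hy, add_tmul]
      | tmul x y =>
        simp [Algebra.algebraMap_eq_smul_one, smul_tmul]
    rw [h4, hA.1]
  rw [homT, LinearMap.comp_apply, LinearMap.comp_apply, h1, theta_nat f h, h2,
    LinearMap.rTensor_tmul]

lemma colin_of_homT_eq {ρA : A →ₗ[k] A ⊗[k] H} {ρB : B →ₗ[k] B ⊗[k] H} (f : A →ₗ[k] B)
    (hA : IsComod k H ρA)
    (h : ∀ a, homT ρA ρB f a = f a ⊗ₜ (1 : H)) (a : A) :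
    ρB (f a) = LinearMap.rTensor H f (ρA a) := by
  let Ξ : (B ⊗[k] H) ⊗[k] H →ₗ[k] B ⊗[k] H :=
    LinearMap.lTensor B (LinearMap.mul' k H) ∘ₗ (TensorProduct.assoc k B H H).toLinearMap
  have h1 : ∀ u : A ⊗[k] H, Ξ (LinearMap.rTensor H (homT ρA ρB f) u) =
      LinearMap.rTensor H f u := by
    intro u
    induction u with
    | zero => simp
    | add x y hx hy => simp only [map_add, hx, hy]
    | tmul x y => simp [Ξ, h]
  rw [← h1]
  let P : A ⊗[k] H →ₗ[k] B ⊗[k] H :=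
    theta ρB ∘ₗ TensorProduct.map f (HopfAlgebra.antipode k (A := H))
  have h2 : LinearMap.rTensor H (homT ρA ρB f) (ρA a) =
      LinearMap.rTensor H P ((TensorProduct.assoc k A H H).symm
        (LinearMap.lTensor A (Coalgebra.comul (R := k) (A := H)) (ρA a))) := by
    rw [← hA.2, LinearEquiv.symm_apply_apply, ← LinearMap.comp_apply (LinearMap.rTensor H P),
      ← LinearMap.rTensor_comp]
    rfl
  have h3 : ∀ (n : A) (w : H ⊗[k] H), Ξ (LinearMap.rTensor H P
      ((TensorProduct.assoc k A H H).symm (n ⊗ₜ w))) =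
      LinearMap.lTensor B (LinearMap.mulRight k (LinearMap.mul' k H
        (LinearMap.rTensor H (HopfAlgebra.antipode k (A := H)) w))) (ρB (f n)) := by
    intro n w
    induction w with
    | zero => simp
    | add x y hx hy =>
      have : ∀ x y : H, LinearMap.mulRight k (x + y) =
        LinearMap.mulRight k x + LinearMap.mulRight k y := by
        intro x y; ext z; simp [mul_add]
      simp only [map_add, tmul_add, hx, hy, this, LinearMap.lTensor_add, LinearMap.add_apply]
    | tmul x y =>
      simp only [TensorProduct.assoc_symm_tmul, LinearMap.rTensor_tmul, P, LinearMap.comp_apply,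
        TensorProduct.map_tmul, theta_tmul, LinearMap.mul'_apply]
      generalize ρB (f n) = z
      induction z with
      | zero => simp
      | add x y hx hy => simp only [map_add, hx, hy, add_tmul]
      | tmul x y => simp [Ξ, mul_assoc]
  have h4 : ∀ u : A ⊗[k] H, Ξ (LinearMap.rTensor H P ((TensorProduct.assoc k A H H).symm
      (LinearMap.lTensor A (Coalgebra.comul (R := k) (A := H)) u))) =
      ρB (f (TensorProduct.rid k A
          (LinearMap.lTensor A (Coalgebra.counit (R := k) (A := H)) u))) := by
    intro u
    induction u with
    | zero => simp
    | add x y hx hy => simp only [map_add, hx, hy]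
    | tmul x y =>
      rw [LinearMap.lTensor_tmul, h3, HopfAlgebra.mul_antipode_rTensor_comul_apply]
      have : LinearMap.mulRight k (algebraMap k H (Coalgebra.counit y)) =
          (Coalgebra.counit (R := k) y) • (LinearMap.id : H →ₗ[k] H) := by
        ext z
        simp [Algebra.algebraMap_eq_smul_one]
      rw [this, LinearMap.lTensor_smul]
      simp
  rw [h2, h4, hA.1]

lemma homT_coassoc {ρB : B →ₗ[k] B ⊗[k] H} (f : A →ₗ[k] B)
    (hB : IsComod k H ρB) (n : A) (w : H ⊗[k] H) (Ψ : (A ⊗[k] H) ⊗[k] H →ₗ[k] (B ⊗[k] H) ⊗[k] H)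
    (hΨ : ∀ x s, Ψ (x ⊗ₜ s) = LinearMap.rTensor H
      (theta ρB ∘ₗ (TensorProduct.mk k B H).flip (HopfAlgebra.antipode k (A := H) s))
      (theta ρB (TensorProduct.map f (HopfAlgebra.antipode k (A := H)) x))) :
    TensorProduct.assoc k B H H (Ψ ((TensorProduct.assoc k A H H).symm (n ⊗ₜ w))) =
      LinearMap.lTensor B (LinearMap.mulRight k (TensorProduct.map
        (HopfAlgebra.antipode k (A := H)) (HopfAlgebra.antipode k (A := H))
          (TensorProduct.comm k H H w)))
        (LinearMap.lTensor B (Coalgebra.comul (R := k) (A := H)) (ρB (f n))) := by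
  induction w with
  | zero => simp
  | add x y hx hy =>
    have : ∀ x y : H ⊗[k] H, LinearMap.mulRight k (x + y) =
      LinearMap.mulRight k x + LinearMap.mulRight k y := by
      intro x y; apply LinearMap.ext; intro z; simp [mul_add]
    simp only [map_add, tmul_add, hx, hy, this, LinearMap.lTensor_add, LinearMap.add_apply]
  | tmul t s =>
    rw [TensorProduct.assoc_symm_tmul, hΨ, TensorProduct.map_tmul, theta_tmul,
      ← hB.2, TensorProduct.comm_tmul, TensorProduct.map_tmul]
    generalize HopfAlgebra.antipode k (A := H) s = s'
    generalize HopfAlgebra.antipode k (A := H) t = t'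
    generalize ρB (f n) = z
    induction z with
    | zero => simp
    | add x y hx hy => simp only [map_add, hx, hy]
    | tmul x y =>
      simp only [LinearMap.lTensor_tmul, LinearMap.rTensor_tmul, LinearMap.comp_apply,
        LinearMap.flip_apply, TensorProduct.mk_apply, theta_tmul]
      generalize ρB x = z
      induction z with
      | zero => simp
      | add x y hx hy => simp only [map_add, hx, hy, add_tmul]
      | tmul x y => simp

lemma comul_theta {ρB : B →ₗ[k] B ⊗[k] H} (b : B) (s : H) :
    LinearMap.lTensor B (Coalgebra.comul (R := k) (A := H)) (theta ρB (b ⊗ₜ s)) =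
      LinearMap.lTensor B (LinearMap.mulRight k (Coalgebra.comul (R := k) s))
        (LinearMap.lTensor B (Coalgebra.comul (R := k) (A := H)) (ρB b)) := by
  rw [theta_tmul]
  generalize ρB b = z
  induction z with
  | zero => simp
  | add x y hx hy => simp only [map_add, hx, hy]
  | tmul x y => simp

end Theta

/-- `f ↦ f(m₀)₀ ⊗ f(m₀)₁ S(m₁)` as a linear map in `f`. -/
def homTlin (X N : LongCat k H) (u : X.M ⊗[k] H) : (X.M →ₗ[H] N.M) →ₗ[k] N.M ⊗[k] H where
  toFun f := theta N.ρ (TensorProduct.map (f.restrictScalars k) (HopfAlgebra.antipode k (A := H)) u)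
  map_add' f g := by
    have : (f + g).restrictScalars k = f.restrictScalars k + g.restrictScalars k := rfl
    rw [this, TensorProduct.map_add_left, LinearMap.add_apply, map_add]
  map_smul' c f := by
    have : (c • f).restrictScalars k = c • f.restrictScalars k := rfl
    rw [this, TensorProduct.map_smul_left, LinearMap.smul_apply, map_smul]
    rfl

lemma homTlin_rho (X N : LongCat k H) (m : X.M) (f : X.M →ₗ[H] N.M) :
    homTlin X N (X.ρ m) f = homT X.ρ N.ρ (f.restrictScalars k) m := rfl

lemma homT_smul (X N : LongCat k H) (f : X.M →ₗ[H] N.M) (h : H) (m : X.M) :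
    homT X.ρ N.ρ (f.restrictScalars k) (h • m) =
      LinearMap.rTensor H (smulMap k H h) (homT X.ρ N.ρ (f.restrictScalars k) m) := by
  simp only [homT, LinearMap.comp_apply]
  rw [X.compat, ← theta_nat (smulMap k H h) (N.compat h)]
  congr 1
  generalize X.ρ m = z
  induction z with
  | zero => simp
  | add x y hx hy => simp only [map_add, hx, hy]
  | tmul x y => simp [smulMap]

lemma exists_homCoact (X N : LongCat k H) (hX : Module.Finite H X.M) :
    ∃ ρ : (X.M →ₗ[H] N.M) →ₗ[k] (X.M →ₗ[H] N.M) ⊗[k] H, ∀ f m,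
      LinearMap.rTensor H (evalAtH (k := k) m) (ρ f) = homTlin X N (X.ρ m) f := by
  choose r hr using fun f : X.M →ₗ[H] N.M =>
    eval_surj hX (homT X.ρ N.ρ (f.restrictScalars k)) (homT_smul X N f)
  refine ⟨{ toFun := r, map_add' := ?_, map_smul' := ?_ }, fun f m => hr f m⟩
  · intro f g
    apply eval_inj
    intro m
    rw [map_add, hr, hr, hr, ← homTlin_rho, map_add]
    rfl
  · intro c f
    apply eval_inj
    intro m
    rw [RingHom.id_apply, map_smul, hr, hr, ← homTlin_rho, map_smul]
    rfl

lemma homCoact_isComod (X N : LongCat k H)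
    (ρ : (X.M →ₗ[H] N.M) →ₗ[k] (X.M →ₗ[H] N.M) ⊗[k] H)
    (hρ : ∀ f m, LinearMap.rTensor H (evalAtH (k := k) m) (ρ f) = homTlin X N (X.ρ m) f) :
    IsComod k H ρ := by
  constructor
  · intro f
    ext m
    have h1 : ∀ x : (X.M →ₗ[H] N.M) ⊗[k] H, (TensorProduct.rid k (X.M →ₗ[H] N.M)
        (LinearMap.lTensor _ (Coalgebra.counit (R := k) (A := H)) x)) m =
        TensorProduct.rid k N.M (LinearMap.lTensor _ (Coalgebra.counit (R := k) (A := H))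
          (LinearMap.rTensor H (evalAtH (k := k) m) x)) := by
      intro x
      induction x with
      | zero => simp
      | add x y hx hy => simp only [map_add, LinearMap.add_apply, hx, hy]
      | tmul x y => simp [evalAtH]
    rw [h1, hρ, homTlin_rho]
    have h2 : ∀ u : X.M ⊗[k] H, TensorProduct.rid k N.M
        (LinearMap.lTensor _ (Coalgebra.counit (R := k) (A := H))
          (theta N.ρ (TensorProduct.map (f.restrictScalars k)
            (HopfAlgebra.antipode k (A := H)) u))) =
        f (TensorProduct.rid k X.M
          (LinearMap.lTensor _ (Coalgebra.counit (R := k) (A := H)) u)) := by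
      intro u
      induction u with
      | zero => simp
      | add x y hx hy => simp only [map_add, hx, hy]
      | tmul x y =>
        rw [TensorProduct.map_tmul, theta_tmul]
        have h3 : ∀ (s : H) (z : N.M ⊗[k] H), TensorProduct.rid k N.M
            (LinearMap.lTensor _ (Coalgebra.counit (R := k) (A := H))
              (LinearMap.lTensor _ (LinearMap.mulRight k s) z)) =
            Coalgebra.counit (R := k) s • TensorProduct.rid k N.M
              (LinearMap.lTensor _ (Coalgebra.counit (R := k) (A := H)) z) := by
          intro s z
          induction z with
          | zero => simp
          | add x y hx hy => simp only [map_add, hx, hy, smul_add]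
          | tmul x y => simp [mul_smul, mul_comm]
        rw [h3, N.comod.1]
        simp only [HopfAlgebra.counit_antipode, LinearMap.lTensor_tmul, TensorProduct.rid_tmul]
        exact ((f.restrictScalars k).map_smul _ _).symm
    exact (h2 (X.ρ m)).trans (by rw [X.comod.1])
  · intro f
    apply eval_inj
    intro m
    have h1 : ∀ x : (X.M →ₗ[H] N.M) ⊗[k] H, LinearMap.rTensor (H ⊗[k] H) (evalAtH (k := k) m)
        (LinearMap.lTensor _ (Coalgebra.comul (R := k) (A := H)) x) =
        LinearMap.lTensor _ (Coalgebra.comul (R := k) (A := H))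
          (LinearMap.rTensor H (evalAtH (k := k) m) x) := by
      intro x
      induction x with
      | zero => simp
      | add x y hx hy => simp only [map_add, hx, hy]
      | tmul x y => simp
    have h2 : ∀ x : (X.M →ₗ[H] N.M) ⊗[k] H, LinearMap.rTensor (H ⊗[k] H) (evalAtH (k := k) m)
        (TensorProduct.assoc k _ H H (LinearMap.rTensor H ρ x)) =
        TensorProduct.assoc k _ H H (LinearMap.rTensor H (homTlin X N (X.ρ m)) x) := by
      intro x
      induction x with
      | zero => simp
      | add x y hx hy => simp only [map_add, hx, hy]
      | tmul x y =>
        rw [LinearMap.rTensor_tmul, LinearMap.rTensor_tmul, ← hρ]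
        generalize ρ x = z
        induction z with
        | zero => simp
        | add x y hx hy => simp only [map_add, hx, hy, add_tmul]
        | tmul x y => simp
    let S := HopfAlgebra.antipode k (A := H)
    let L : H →ₗ[k] (N.M →ₗ[k] N.M ⊗[k] H) :=
      ((TensorProduct.mk k N.M H).flip.compr₂ (theta N.ρ)) ∘ₗ S
    let Ψ : (X.M ⊗[k] H) ⊗[k] H →ₗ[k] (N.M ⊗[k] H) ⊗[k] H :=
      TensorProduct.lift ((LinearMap.rTensorHom H ∘ₗ L).flip ∘ₗ
        (theta N.ρ ∘ₗ TensorProduct.map (f.restrictScalars k) S))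
    have hΨ : ∀ x s, Ψ (x ⊗ₜ s) = LinearMap.rTensor H
        (theta N.ρ ∘ₗ (TensorProduct.mk k N.M H).flip (HopfAlgebra.antipode k (A := H) s))
        (theta N.ρ (TensorProduct.map (f.restrictScalars k)
          (HopfAlgebra.antipode k (A := H)) x)) := fun x s => rfl
    have h3 : ∀ u : X.M ⊗[k] H, LinearMap.rTensor H (homTlin X N u) (ρ f) =
        Ψ (LinearMap.rTensor H X.ρ u) := by
      intro u
      induction u with
      | zero =>
        have : homTlin X N 0 = 0 := by
          apply LinearMap.ext
          intro f
          simp [homTlin]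
        simp [this]
      | add x y hx hy =>
        have : homTlin X N (x + y) = homTlin X N x + homTlin X N y := by
          apply LinearMap.ext
          intro f
          simp [homTlin]
        rw [this, LinearMap.rTensor_add, LinearMap.add_apply, hx, hy, map_add, map_add]
      | tmul n s =>
        rw [LinearMap.rTensor_tmul, hΨ]
        have h4 : theta N.ρ (TensorProduct.map (f.restrictScalars k)
          (HopfAlgebra.antipode k (A := H)) (X.ρ n)) =
          LinearMap.rTensor H (evalAtH (k := k) n) (ρ f) := (hρ f n).symm
        rw [h4]
        refine Eq.trans ?_ (LinearMap.congr_fun (LinearMap.rTensor_comp H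
          (theta N.ρ ∘ₗ (TensorProduct.mk k N.M H).flip (HopfAlgebra.antipode k (A := H) s))
          (evalAtH (k := k) n)) (ρ f))
        rfl
    rw [h1, h2, hρ, h3]
    have h5 : LinearMap.rTensor H X.ρ (X.ρ m) = (TensorProduct.assoc k X.M H H).symm
        (LinearMap.lTensor X.M (Coalgebra.comul (R := k) (A := H)) (X.ρ m)) := by
      rw [← X.comod.2, LinearEquiv.symm_apply_apply]
    rw [h5, homTlin_rho]
    have h6 : ∀ u : X.M ⊗[k] H, TensorProduct.assoc k N.M H H
        (Ψ ((TensorProduct.assoc k X.M H H).symm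
          (LinearMap.lTensor X.M (Coalgebra.comul (R := k) (A := H)) u))) =
        LinearMap.lTensor N.M (Coalgebra.comul (R := k) (A := H))
          (theta N.ρ (TensorProduct.map (f.restrictScalars k)
            (HopfAlgebra.antipode k (A := H)) u)) := by
      intro u
      induction u with
      | zero => simp
      | add x y hx hy => simp only [map_add, hx, hy]
      | tmul n h =>
        rw [LinearMap.lTensor_tmul, homT_coassoc _ N.comod n _ Ψ hΨ, TensorProduct.map_tmul,
          comul_theta]
        have := LinearMap.congr_fun (anti_comul k H) h
        simp only [LinearMap.comp_apply, LinearEquiv.coe_coe] at this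
        rw [this]
    exact h6 (X.ρ m)

lemma homCoact_colin (X N N' : LongCat k H) (g : N.M →ₗ[k] N'.M) (hg : IsHom k H N.ρ N'.ρ g)
    (ρ : (X.M →ₗ[H] N.M) →ₗ[k] (X.M →ₗ[H] N.M) ⊗[k] H)
    (hρ : ∀ f m, LinearMap.rTensor H (evalAtH (k := k) m) (ρ f) = homTlin X N (X.ρ m) f)
    (ρ' : (X.M →ₗ[H] N'.M) →ₗ[k] (X.M →ₗ[H] N'.M) ⊗[k] H)
    (hρ' : ∀ f m, LinearMap.rTensor H (evalAtH (k := k) m) (ρ' f) = homTlin X N' (X.ρ m) f) :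
    IsColin k H ρ ρ' (postcompH (X := X.M) g hg.1) := by
  apply LinearMap.ext
  intro f
  apply eval_inj
  intro m
  rw [LinearMap.comp_apply, LinearMap.comp_apply, hρ',
    ← LinearMap.comp_apply (LinearMap.rTensor H _), ← LinearMap.rTensor_comp]
  have h1 : evalAtH (k := k) m ∘ₗ postcompH (X := X.M) g hg.1 = g ∘ₗ evalAtH (k := k) m := rfl
  rw [h1, LinearMap.rTensor_comp, LinearMap.comp_apply, hρ]
  have h2 : ∀ a, N'.ρ (g a) = LinearMap.rTensor H g (N.ρ a) := fun a => LinearMap.congr_fun hg.2 a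
  have h3 : homTlin X N (X.ρ m) f = theta N.ρ (TensorProduct.map (f.restrictScalars k)
    (HopfAlgebra.antipode k (A := H)) (X.ρ m)) := rfl
  rw [h3, ← theta_nat g h2, ← LinearMap.comp_apply (LinearMap.rTensor H g),
    LinearMap.rTensor_comp_map]
  rfl

end Aux

/-- Proposition 3.6. Let `k` be a field and `H` a Hopf algebra
over `k` with bijective antipode. If the category of Long dimodules satisfies
condition (†) and the coinvariants functor is exact on right `H`-comodules, then
every Long dimodule which is finitely generated as a left `H`-module is a
projective object in the category of Long dimodules. -/
theorem fg_Long_projective_of_dagger_and_coinvariants_exact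
    (k H : Type) [Field k] [Ring H] [HopfAlgebra k H]
    (Sinv : H →ₗ[k] H)
    (hS1 : ∀ h : H, Sinv (HopfAlgebra.antipode (R := k) (A := H) h) = h)
    (hS2 : ∀ h : H, HopfAlgebra.antipode (R := k) (A := H) (Sinv h) = h)
    (hdagger : DaggerLong k H)
    (hcoinv : CoinvExactComod k H) :
    ∀ A : LongCat k H, Module.Finite H A.M → IsProjectiveLong k H A := by
  intro X hX A B g f hg hgs hf
  obtain ⟨K, ι, hι, hιinj, hex⟩ := exists_kernel A B g hg
  obtain ⟨d1, d2, d3⟩ := hdagger X hX K A B ι g hι hg hιinj hgs hex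
  obtain ⟨ρK, hρK⟩ := exists_homCoact X K hX
  obtain ⟨ρA, hρA⟩ := exists_homCoact X A hX
  obtain ⟨ρB, hρB⟩ := exists_homCoact X B hX
  have key := hcoinv ⟨_, ρK, homCoact_isComod X K ρK hρK⟩ ⟨_, ρA, homCoact_isComod X A ρA hρA⟩
    ⟨_, ρB, homCoact_isComod X B ρB hρB⟩ _ _ (homCoact_colin X K A ι hι ρK hρK ρA hρA)
    (homCoact_colin X A B g hg ρA hρA ρB hρB) d1 d3 d2
  let fH : X.M →ₗ[H] B.M := { toFun := f, map_add' := map_add f, map_smul' := hf.1 }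
  have hfco : fH ∈ coinv ρB := by
    rw [mem_coinv]
    apply eval_inj
    intro m
    rw [hρB, homTlin_rho]
    exact homT_eq_of_colin f X.comod (fun a => LinearMap.congr_fun hf.2 a) m
  obtain ⟨⟨l, hl⟩, hl2⟩ := key.2.2 ⟨fH, hfco⟩
  have hl3 : postcompH (X := X.M) g hg.1 l = fH := congrArg Subtype.val hl2
  refine ⟨l.restrictScalars k, ⟨fun h a => l.map_smul h a, ?_⟩, ?_⟩
  · apply LinearMap.ext
    intro a
    refine colin_of_homT_eq (l.restrictScalars k) X.comod (fun m => ?_) a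
    rw [← homTlin_rho, ← hρA, mem_coinv.1 hl]
    rfl
  · apply LinearMap.ext
    intro a
    exact LinearMap.congr_fun hl3 a
end YDPaper
end
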